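/- Let R be real with -1 < R < 1 and X a nonzero complex number, and define F(X,R) = (R;R)_∞ (-X;R)_∞ (-R/X;R)_∞. Then (F(X,R) + F(-X,R))/2 = F(R X^2, R^4) and (F(X,R) - F(-X,R))/2 = X · F(R^3 X^2, R^4). -/

import Mathlib

/-- `F(X,R) = (R;R)_∞ (-X;R)_∞ (-R/X;R)_∞`. -/
noncomputable def jacobiF (X R : ℂ) : ℂ :=
  (∏' k : ℕ, (1 - R * R ^ k)) * (∏' k : ℕ, (1 + X * R ^ k)) * (∏' k : ℕ, (1 + (R / X) * R ^ k))

open Filter Topology Finset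

/-- The finite `q`-Pochhammer symbol `(q;q)_n`. -/
noncomputable def qPoch (q : ℂ) (n : ℕ) : ℂ := ∏ k ∈ range n, (1 - q * q ^ k)

/-- The general term `q^(m(m-1)/2) x^m` of the Jacobi theta series. -/
noncomputable def thetaTerm (x q : ℂ) (m : ℤ) : ℂ := q ^ (m * (m - 1) / 2) * x ^ m

lemma Int.two_mul_mul_pred_div_two (m : ℤ) : 2 * (m * (m - 1) / 2) = m * (m - 1) :=
  Int.mul_ediv_cancel' (Int.even_mul_pred_self m).two_dvd

lemma thetaTerm_ne_zero {x q : ℂ} (hx : x ≠ 0) (hq : q ≠ 0) (m : ℤ) : thetaTerm x q m ≠ 0 :=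
  mul_ne_zero (zpow_ne_zero _ hq) (zpow_ne_zero _ hx)

lemma thetaTerm_add_one {x q : ℂ} (hx : x ≠ 0) (hq : q ≠ 0) (m : ℤ) :
    thetaTerm x q (m + 1) = q ^ m * x * thetaTerm x q m := by
  have h : (m + 1) * (m + 1 - 1) / 2 = m + m * (m - 1) / 2 := by
    have h1 := Int.two_mul_mul_pred_div_two m
    have h2 := Int.two_mul_mul_pred_div_two (m + 1)
    linarith
  rw [thetaTerm, thetaTerm, h, zpow_add₀ hq, zpow_add_one₀ hx]
  ring

lemma thetaTerm_two_mul (x : ℂ) {q : ℂ} (hq : q ≠ 0) (m : ℤ) :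
    thetaTerm x q (2 * m) = thetaTerm (q * x ^ 2) (q ^ 4) m := by
  have h : (2 * m) * (2 * m - 1) / 2 = 4 * (m * (m - 1) / 2) + m := by
    have h1 := Int.two_mul_mul_pred_div_two m
    have h2 := Int.two_mul_mul_pred_div_two (2 * m)
    linarith
  rw [thetaTerm, thetaTerm, h, zpow_add₀ hq, mul_zpow, zpow_mul, zpow_mul]
  norm_cast
  ring

lemma thetaTerm_two_mul_add_one {x q : ℂ} (hx : x ≠ 0) (hq : q ≠ 0) (m : ℤ) :
    thetaTerm x q (2 * m + 1) = x * thetaTerm (q ^ 3 * x ^ 2) (q ^ 4) m := by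
  rw [thetaTerm_add_one hx hq, thetaTerm_two_mul x hq, thetaTerm, thetaTerm]
  simp only [mul_zpow, zpow_mul]
  have h : (q ^ 3) ^ m = (q ^ (2 : ℤ)) ^ m * q ^ m := by
    rw [← mul_zpow]
    norm_cast
  rw [h]
  ring

lemma summable_thetaTerm {x q : ℂ} (hx : x ≠ 0) (hq : q ≠ 0) (hq1 : ‖q‖ < 1) :
    Summable (thetaTerm x q) := by
  have hpow := tendsto_pow_atTop_nhds_zero_of_norm_lt_one hq1
  apply Summable.of_nat_of_neg
  · refine summable_of_ratio_test_tendsto_lt_one zero_lt_one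
      (Eventually.of_forall fun n => thetaTerm_ne_zero hx hq n) ?_
    have h := (hpow.mul_const x).norm
    rw [zero_mul, norm_zero] at h
    refine h.congr fun n => ?_
    rw [← norm_div, Nat.cast_add_one, thetaTerm_add_one hx hq,
      mul_div_cancel_right₀ _ (thetaTerm_ne_zero hx hq _), zpow_natCast]
  · refine summable_of_ratio_test_tendsto_lt_one zero_lt_one
      (Eventually.of_forall fun n => thetaTerm_ne_zero hx hq _) ?_
    have h := ((hpow.comp (tendsto_add_atTop_nat 1)).mul_const x⁻¹).norm
    rw [zero_mul, norm_zero] at h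
    refine h.congr fun n => ?_
    have h2 := thetaTerm_add_one hx hq (-((n + 1 : ℕ) : ℤ))
    rw [show -((n + 1 : ℕ) : ℤ) + 1 = -(n : ℤ) by push_cast; ring, zpow_neg, zpow_natCast] at h2
    have h3 := thetaTerm_ne_zero hx hq (-((n + 1 : ℕ) : ℤ))
    rw [← norm_div, h2]
    congr 1
    simp only [Function.comp_apply]
    field_simp

lemma one_sub_mul_pow_ne_zero {q : ℂ} (hq1 : ‖q‖ < 1) (k : ℕ) : 1 - q * q ^ k ≠ 0 := by
  rw [← pow_succ', sub_ne_zero]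
  intro h
  have h2 := pow_lt_one₀ (norm_nonneg q) hq1 k.succ_ne_zero
  rw [← norm_pow, ← h, norm_one] at h2
  exact lt_irrefl _ h2

lemma qPoch_succ (q : ℂ) (n : ℕ) : qPoch q (n + 1) = qPoch q n * (1 - q * q ^ n) :=
  prod_range_succ _ _

lemma qPoch_ne_zero {q : ℂ} (hq1 : ‖q‖ < 1) (n : ℕ) : qPoch q n ≠ 0 :=
  prod_ne_zero_iff.mpr fun k _ => one_sub_mul_pow_ne_zero hq1 k

lemma summable_norm_mul_pow {q : ℂ} (hq1 : ‖q‖ < 1) (a : ℂ) :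
    Summable fun k : ℕ => ‖a * q ^ k‖ := by
  simp only [norm_mul, norm_pow]
  exact (summable_geometric_of_lt_one (norm_nonneg q) hq1).mul_left _

lemma tendsto_prod_one_add_mul_pow {q : ℂ} (hq1 : ‖q‖ < 1) (a : ℂ) :
    Tendsto (fun n => ∏ k ∈ range n, (1 + a * q ^ k)) atTop (𝓝 (∏' k : ℕ, (1 + a * q ^ k))) :=
  (multipliable_one_add_of_summable (summable_norm_mul_pow hq1 a)).tendsto_prod_tprod_nat

lemma tendsto_qPoch {q : ℂ} (hq1 : ‖q‖ < 1) :
    Tendsto (qPoch q) atTop (𝓝 (∏' k : ℕ, (1 - q * q ^ k))) := by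
  change Tendsto (fun n => ∏ k ∈ range n, (1 - q * q ^ k)) atTop _
  simpa only [neg_mul, ← sub_eq_add_neg] using tendsto_prod_one_add_mul_pow hq1 (-q)

lemma tprod_one_sub_mul_pow_ne_zero {q : ℂ} (hq1 : ‖q‖ < 1) :
    ∏' k : ℕ, (1 - q * q ^ k) ≠ 0 := by
  have h := tprod_one_add_ne_zero_of_summable (f := fun k : ℕ => -q * q ^ k)
    (fun k => by simpa only [neg_mul, ← sub_eq_add_neg] using one_sub_mul_pow_ne_zero hq1 k)
    (summable_norm_mul_pow hq1 (-q))
  simpa only [neg_mul, ← sub_eq_add_neg] using h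

/-- The finite `q`-binomial theorem. -/
lemma prod_one_add_mul_pow_eq_sum {q : ℂ} (hq1 : ‖q‖ < 1) (x : ℂ) (n : ℕ) :
    ∏ k ∈ range n, (1 + x * q ^ k) = ∑ j ∈ range (n + 1),
      qPoch q n / (qPoch q j * qPoch q (n - j)) * (q ^ j.choose 2 * x ^ j) := by
  have hP := qPoch_ne_zero hq1
  have h0 : qPoch q 0 = 1 := prod_range_zero _
  induction n with
  | zero => simp [h0]
  | succ n ih =>
    have key : ∀ j ∈ range n,
        qPoch q (n + 1) / (qPoch q (j + 1) * qPoch q (n + 1 - (j + 1))) *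
          (q ^ (j + 1).choose 2 * x ^ (j + 1)) =
        qPoch q n / (qPoch q (j + 1) * qPoch q (n - (j + 1))) *
          (q ^ (j + 1).choose 2 * x ^ (j + 1)) +
        x * q ^ n * (qPoch q n / (qPoch q j * qPoch q (n - j)) * (q ^ j.choose 2 * x ^ j)) := by
      intro j hj
      obtain ⟨d, rfl⟩ := Nat.exists_eq_add_of_lt (mem_range.mp hj)
      rw [show j + d + 1 + 1 - (j + 1) = d + 1 by lia, show j + d + 1 - (j + 1) = d by lia,
        show j + d + 1 - j = d + 1 by lia, qPoch_succ q (j + d + 1), qPoch_succ q j,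
        qPoch_succ q d, show (j + 1).choose 2 = j + j.choose 2 by
          rw [Nat.choose_succ_succ' j 1, Nat.choose_one_right]]
      have h1 := hP j
      have h2 := hP d
      have h3 := one_sub_mul_pow_ne_zero hq1 j
      have h4 := one_sub_mul_pow_ne_zero hq1 d
      field_simp
      ring
    have htop : qPoch q (n + 1) / (qPoch q (n + 1) * qPoch q (n + 1 - (n + 1))) *
          (q ^ (n + 1).choose 2 * x ^ (n + 1)) =
        x * q ^ n * (qPoch q n / (qPoch q n * qPoch q (n - n)) * (q ^ n.choose 2 * x ^ n)) := by
      rw [Nat.sub_self, Nat.sub_self, h0, mul_one, mul_one, div_self (hP _), div_self (hP _),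
        Nat.choose_succ_succ' n 1, Nat.choose_one_right]
      ring
    have hbot : qPoch q (n + 1) / (qPoch q 0 * qPoch q (n + 1 - 0)) *
          (q ^ (0).choose 2 * x ^ 0) =
        qPoch q n / (qPoch q 0 * qPoch q (n - 0)) * (q ^ (0).choose 2 * x ^ 0) := by
      simp [h0, div_self (hP _)]
    rw [sum_range_succ, sum_range_succ', sum_congr rfl key, sum_add_distrib, htop, hbot,
      ← mul_sum, prod_range_succ, mul_add, mul_one]
    conv_lhs => arg 1; rw [ih, sum_range_succ']
    rw [ih, sum_range_succ _ n]
    ring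

lemma prod_one_add_mul_zpow_mul_pow {x q : ℂ} (hx : x ≠ 0) (hq : q ≠ 0) (n : ℕ) :
    ∏ k ∈ range n, (1 + x * q ^ (-n : ℤ) * q ^ k) =
      x ^ n * (q ^ (n + 1).choose 2)⁻¹ * ∏ k ∈ range n, (1 + q / x * q ^ k) := by
  rw [← prod_range_reflect]
  have h : ∀ k ∈ range n, 1 + x * q ^ (-n : ℤ) * q ^ (n - 1 - k) =
      1 + x / q ^ (k + 1) := by
    intro k hk
    obtain ⟨d, rfl⟩ := Nat.exists_eq_add_of_lt (mem_range.mp hk)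
    rw [show k + d + 1 - 1 - k = d by lia, zpow_neg, zpow_natCast]
    field_simp
    ring
  rw [prod_congr rfl h]
  clear h
  induction n with
  | zero => simp
  | succ n ih =>
    rw [prod_range_succ, ih, prod_range_succ _ n, Nat.choose_succ_succ' (n + 1) 1,
      Nat.choose_one_right]
    field_simp
    ring

/-- A finite form of the Jacobi triple product identity. -/
lemma prod_mul_prod_eq_sum_thetaTerm {x q : ℂ} (hx : x ≠ 0) (hq : q ≠ 0) (hq1 : ‖q‖ < 1)
    (n : ℕ) :
    (∏ k ∈ range n, (1 + x * q ^ k)) * ∏ k ∈ range n, (1 + q / x * q ^ k) =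
      ∑ j ∈ range (2 * n + 1), qPoch q (2 * n) / (qPoch q j * qPoch q (2 * n - j)) *
        thetaTerm x q (j - n) := by
  have h := prod_one_add_mul_pow_eq_sum hq1 (x * q ^ (-n : ℤ)) (2 * n)
  have h2 : ∀ k : ℕ, 1 + x * q ^ (-n : ℤ) * q ^ (n + k) = 1 + x * q ^ k := by
    intro k
    rw [zpow_neg, zpow_natCast, pow_add]
    field_simp
  have hterm : ∀ j : ℕ, thetaTerm x q (j - n) =
      (x ^ n)⁻¹ * q ^ (n + 1).choose 2 * (q ^ j.choose 2 * (x * q ^ (-n : ℤ)) ^ j) := by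
    intro j
    have e : ((j : ℤ) - n) * (j - n - 1) / 2 =
        ((n + 1).choose 2 : ℕ) + (j.choose 2 : ℕ) + -n * j := by
      have h1 := Int.two_mul_mul_pred_div_two ((j : ℤ) - n)
      have hc : ∀ i : ℕ, 2 * ((i.choose 2 : ℕ) : ℤ) = i * (i - 1) := by
        intro i
        induction i with
        | zero => simp
        | succ i ih =>
          rw [Nat.choose_succ_succ' i 1, Nat.choose_one_right]
          push_cast
          linarith
      have h3 := hc (n + 1)
      have h4 := hc j
      push_cast at h3
      linarith
    rw [thetaTerm, e, zpow_add₀ hq, zpow_add₀ hq, zpow_mul, zpow_natCast, zpow_natCast,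
      zpow_natCast, zpow_sub₀ hx, zpow_natCast, zpow_natCast, mul_pow]
    ring
  rw [two_mul n, prod_range_add, ← two_mul, prod_one_add_mul_zpow_mul_pow hx hq,
    prod_congr rfl fun k _ => h2 k] at h
  have h5 : (x ^ n)⁻¹ * q ^ (n + 1).choose 2 *
      (x ^ n * (q ^ (n + 1).choose 2)⁻¹ * ∏ k ∈ range n, (1 + q / x * q ^ k)) =
      ∏ k ∈ range n, (1 + q / x * q ^ k) := by
    field_simp
  rw [mul_comm, ← h5, mul_assoc, h, mul_sum]
  refine sum_congr rfl fun j _ => ?_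
  rw [hterm]
  ring

/-- The coefficient of `thetaTerm x q m` in the finite Jacobi triple product identity. -/
noncomputable def thetaCoeff (q : ℂ) (n : ℕ) (m : ℤ) : ℂ :=
  if -n ≤ m ∧ m ≤ n then
    qPoch q (2 * n) / (qPoch q (n + m).toNat * qPoch q (n - m).toNat) else 0

lemma prod_mul_prod_eq_tsum_thetaCoeff {x q : ℂ} (hx : x ≠ 0) (hq : q ≠ 0) (hq1 : ‖q‖ < 1)
    (n : ℕ) :
    (∏ k ∈ range n, (1 + x * q ^ k)) * ∏ k ∈ range n, (1 + q / x * q ^ k) =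
      ∑' m : ℤ, thetaCoeff q n m * thetaTerm x q m := by
  rw [prod_mul_prod_eq_sum_thetaTerm hx hq hq1,
    tsum_eq_sum (s := (range (2 * n + 1)).image fun j : ℕ => (j : ℤ) - n), sum_image]
  · refine sum_congr rfl fun j hj => ?_
    have hj := mem_range.mp hj
    rw [thetaCoeff, if_pos (by lia), show ((n : ℤ) + (j - n)).toNat = j by lia,
      show ((n : ℤ) - (j - n)).toNat = 2 * n - j by lia]
  · intro a _ b _ hab
    simpa using hab
  · intro m hm
    rw [thetaCoeff, if_neg, zero_mul]
    intro h
    exact hm (mem_image.mpr ⟨(n + m).toNat, mem_range.mpr (by lia), by lia⟩)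

lemma tendsto_thetaCoeff {q : ℂ} (hq1 : ‖q‖ < 1) (m : ℤ) :
    Tendsto (fun n => thetaCoeff q n m) atTop (𝓝 (∏' k : ℕ, (1 - q * q ^ k))⁻¹) := by
  have hp := tprod_one_sub_mul_pow_ne_zero hq1
  have hP := tendsto_qPoch hq1
  have h1 : Tendsto (fun n : ℕ => 2 * n) atTop atTop :=
    tendsto_atTop_mono (fun n => by rw [id]; lia) tendsto_id
  have h2 : Tendsto (fun n : ℕ => ((n : ℤ) + m).toNat) atTop atTop :=
    tendsto_atTop_mono (fun n => by lia) (tendsto_sub_atTop_nat m.natAbs)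
  have h3 : Tendsto (fun n : ℕ => ((n : ℤ) - m).toNat) atTop atTop :=
    tendsto_atTop_mono (fun n => by lia) (tendsto_sub_atTop_nat m.natAbs)
  have h := (hP.comp h1).div ((hP.comp h2).mul (hP.comp h3)) (mul_ne_zero hp hp)
  rw [div_mul_cancel_left₀ hp] at h
  refine h.congr' ?_
  filter_upwards [eventually_ge_atTop m.natAbs] with n hn
  rw [thetaCoeff, if_pos (by lia)]
  rfl

lemma exists_norm_thetaCoeff_le {q : ℂ} (hq1 : ‖q‖ < 1) :
    ∃ C : ℝ, ∀ n m, ‖thetaCoeff q n m‖ ≤ C := by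
  have hP := tendsto_qPoch hq1
  obtain ⟨A, hA⟩ := hP.norm.bddAbove_range
  obtain ⟨B, hB⟩ := (hP.inv₀ (tprod_one_sub_mul_pow_ne_zero hq1)).norm.bddAbove_range
  have hA' : ∀ n, ‖qPoch q n‖ ≤ A := fun n => hA ⟨n, rfl⟩
  have hB' : ∀ n, ‖(qPoch q n)⁻¹‖ ≤ B := fun n => hB ⟨n, rfl⟩
  have hA0 : 0 ≤ A := (norm_nonneg _).trans (hA' 0)
  have hB0 : 0 ≤ B := (norm_nonneg _).trans (hB' 0)
  refine ⟨A * (B * B), fun n m => ?_⟩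
  rw [thetaCoeff]
  split_ifs
  · rw [div_eq_mul_inv, mul_inv, norm_mul, norm_mul]
    gcongr
    exacts [hA' _, hB' _, hB' _]
  · rw [norm_zero]
    positivity

/-- The Jacobi triple product identity. -/
lemma hasSum_thetaTerm {x q : ℂ} (hx : x ≠ 0) (hq : q ≠ 0) (hq1 : ‖q‖ < 1) :
    HasSum (thetaTerm x q) (jacobiF x q) := by
  have hs := summable_thetaTerm hx hq hq1
  have hp := tprod_one_sub_mul_pow_ne_zero hq1
  obtain ⟨C, hC⟩ := exists_norm_thetaCoeff_le hq1
  have h1 := tendsto_tsum_of_dominated_convergence (𝓕 := atTop)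
    (f := fun n m => thetaCoeff q n m * thetaTerm x q m) (hs.norm.mul_left C)
    (fun m => (tendsto_thetaCoeff hq1 m).mul_const (thetaTerm x q m))
    (Eventually.of_forall fun n m => by
      rw [norm_mul]
      gcongr
      exact hC n m)
  have h2 := (tendsto_prod_one_add_mul_pow hq1 x).mul (tendsto_prod_one_add_mul_pow hq1 (q / x))
  simp only [← prod_mul_prod_eq_tsum_thetaCoeff hx hq hq1] at h1
  have h3 := tendsto_nhds_unique h2 h1
  rw [tsum_mul_left] at h3
  rw [hs.hasSum_iff, jacobiF, mul_assoc, h3, mul_inv_cancel_left₀ hp]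

lemma HasSum.int_even_add_odd {f : ℤ → ℂ} {a b : ℂ} (he : HasSum (fun m => f (2 * m)) a)
    (ho : HasSum (fun m => f (2 * m + 1)) b) : HasSum f (a + b) := by
  have hinj := mul_right_injective₀ (two_ne_zero' ℤ)
  replace ho := ((add_left_injective 1).comp hinj).hasSum_range_iff.2 ho
  refine (hinj.hasSum_range_iff.2 he).add_isCompl ?_ ho
  simpa [Function.comp_def] using Int.isCompl_even_odd

/-- Even/odd parts of the Jacobi triple product:
`(F(X,R) + F(-X,R))/2 = F(R X², R⁴)` and `(F(X,R) - F(-X,R))/2 = X F(R³ X², R⁴)`. -/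
theorem jacobiF_even_odd (R : ℝ) (X : ℂ) (hR1 : -1 < R) (hR2 : R < 1) (hX : X ≠ 0) :
    (jacobiF X (R : ℂ) + jacobiF (-X) (R : ℂ)) / 2 = jacobiF ((R : ℂ) * X ^ 2) ((R : ℂ) ^ 4) ∧
    (jacobiF X (R : ℂ) - jacobiF (-X) (R : ℂ)) / 2 =
      X * jacobiF ((R : ℂ) ^ 3 * X ^ 2) ((R : ℂ) ^ 4) := by
  have hnorm : ‖(R : ℂ)‖ < 1 := by
    rw [Complex.norm_real, Real.norm_eq_abs, abs_lt]
    exact ⟨hR1, hR2⟩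
  rcases eq_or_ne R 0 with rfl | hR
  · have h (a : ℂ) : ∏' k : ℕ, (1 + a * 0 ^ k) = 1 + a := by
      rw [tprod_eq_mulSingle 0 fun k hk => by simp [hk]]
      simp
    simp only [jacobiF, Complex.ofReal_zero, h]
    simp
    ring
  have hq : (R : ℂ) ≠ 0 := Complex.ofReal_ne_zero.mpr hR
  set q : ℂ := (R : ℂ)
  have hq4 : q ^ 4 ≠ 0 := pow_ne_zero _ hq
  have hnorm4 : ‖q ^ 4‖ < 1 := by
    rw [norm_pow]
    exact pow_lt_one₀ (norm_nonneg _) hnorm (by norm_num)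
  have hE := hasSum_thetaTerm (mul_ne_zero hq (pow_ne_zero 2 hX)) hq4 hnorm4
  have hO := (hasSum_thetaTerm (mul_ne_zero (pow_ne_zero 3 hq) (pow_ne_zero 2 hX)) hq4
    hnorm4).mul_left X
  have hadd : HasSum (thetaTerm X q)
      (jacobiF (q * X ^ 2) (q ^ 4) + X * jacobiF (q ^ 3 * X ^ 2) (q ^ 4)) := by
    apply HasSum.int_even_add_odd
    · simpa only [thetaTerm_two_mul X hq] using hE
    · simpa only [thetaTerm_two_mul_add_one hX hq] using hO
  have hsub : HasSum (thetaTerm (-X) q)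
      (jacobiF (q * X ^ 2) (q ^ 4) + -X * jacobiF (q ^ 3 * X ^ 2) (q ^ 4)) := by
    have hX' := neg_ne_zero.mpr hX
    apply HasSum.int_even_add_odd
    · simpa only [thetaTerm_two_mul (-X) hq, neg_sq] using hE
    · simpa only [thetaTerm_two_mul_add_one hX' hq, neg_sq, neg_mul] using hO.neg
  rw [(hasSum_thetaTerm hX hq hnorm).unique hadd,
    (hasSum_thetaTerm (neg_ne_zero.mpr hX) hq hnorm).unique hsub]
  constructor <;> ring
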